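/- arXiv:2302.01808 — 3 statements merged into one kernel-verified Lean document; each statement's English description precedes it below -/
import Mathlib

section
/- Let S⃗ be a finite submodular separation system inside a universe of separations, let 𝒫 be a set of profiles of S, and let M ⊆ S be a nested set of separations, each good for 𝒫, such that all profiles in 𝒫 contain exactly the same orientations of the elements of M; write S_M for the set of separations in S nested with M and P_M := P ∩ S⃗_M for a profile P, where S⃗_M is the set of orientations of elements of S_M. Let P, Q, Q' ∈ 𝒫 be three distinct profiles, and let r, s ∈ P_M be two distinct oriented separations with r*, s* ∈ Q'. If r* is closely related to Q and s* is closely related to Q', then there is an oriented separation u ∈ P_M with r ∨ s ≤ u whose underlying separation distinguishes P and Q well. -/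
namespace SepSys

variable {U : Type*} [Lattice U]

/-- `inv` is an order-reversing involution on the universe `U`. -/
def IsInvol (inv : U → U) : Prop :=
  (∀ s, inv (inv s) = s) ∧ ∀ r s : U, r ≤ s → inv s ≤ inv r

/-- `Sv` is a separation system inside the universe `U`: a subset closed under the involution. -/
def IsSepSys (inv : U → U) (Sv : Set U) : Prop :=
  ∀ s ∈ Sv, inv s ∈ Sv

/-- structural submodularity of a separation system inside a universe -/
def SubmodularSys (Sv : Set U) : Prop :=
  ∀ r ∈ Sv, ∀ s ∈ Sv, r ⊔ s ∈ Sv ∨ r ⊓ s ∈ Sv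

/-- the (unoriented) separations underlying `r` and `s` are nested -/
def Nested (inv : U → U) (r s : U) : Prop :=
  r ≤ s ∨ r ≤ inv s ∨ inv r ≤ s ∨ inv r ≤ inv s

def NestedSet (inv : U → U) (N : Set U) : Prop :=
  ∀ r ∈ N, ∀ s ∈ N, Nested inv r s

def NestedWithAll (inv : U → U) (M : Set U) (s : U) : Prop :=
  ∀ m ∈ M, Nested inv s m

/-- `N` represents a set of unoriented separations of `Sv`:
we represent such a set by the set of all orientations of its elements. -/
def UnorientedIn (inv : U → U) (Sv N : Set U) : Prop :=
  N ⊆ Sv ∧ ∀ s ∈ N, inv s ∈ N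

/-- `O` is an orientation of (the set of unoriented separations of) `Sv` -/
def IsOrientation (inv : U → U) (Sv O : Set U) : Prop :=
  O ⊆ Sv ∧ (∀ s ∈ Sv, s ∈ O ∨ inv s ∈ O) ∧ ∀ s ∈ O, inv s ∈ O → inv s = s

def Consistent (inv : U → U) (O : Set U) : Prop :=
  ∀ a ∈ O, ∀ b ∈ O, a ≠ b → ¬ inv a < b

def IsProfile (inv : U → U) (Sv P : Set U) : Prop :=
  IsOrientation inv Sv P ∧ Consistent inv P ∧ ∀ r ∈ P, ∀ s ∈ P, inv (r ⊔ s) ∉ P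

def IsStarIn (inv : U → U) (Sv σ : Set U) : Prop :=
  σ ⊆ Sv ∧ (∀ s ∈ σ, inv s ≠ s) ∧ ∀ r ∈ σ, ∀ s ∈ σ, r ≠ s → r ≤ inv s

def IsFTangle (inv : U → U) (Sv : Set U) (F : Set (Set U)) (O : Set U) : Prop :=
  IsOrientation inv Sv O ∧ Consistent inv O ∧ ∀ σ ∈ F, ¬ σ ⊆ O

/-- the non-degenerate separation underlying `s` distinguishes `O` and `O'` -/
def Distinguishes (inv : U → U) (s : U) (O O' : Set U) : Prop :=
  inv s ≠ s ∧ ((s ∈ O ∧ inv s ∈ O') ∨ (inv s ∈ O ∧ s ∈ O'))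

def DistinguishesAll (inv : U → U) (N : Set U) (Ps : Set (Set U)) : Prop :=
  ∀ P ∈ Ps, ∀ P' ∈ Ps, P ≠ P' → ∃ s ∈ N, Distinguishes inv s P P'

def CloselyRelated (inv : U → U) (Sv O : Set U) (s : U) : Prop :=
  s ∈ O ∧ ∀ r ∈ O, s ⊓ r ∈ Sv

def DistinguishesWell (inv : U → U) (Sv P P' : Set U) (s : U) : Prop :=
  (CloselyRelated inv Sv P s ∧ CloselyRelated inv Sv P' (inv s)) ∨
    (CloselyRelated inv Sv P' s ∧ CloselyRelated inv Sv P (inv s))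

def GoodFor (inv : U → U) (Sv : Set U) (Ps : Set (Set U)) (s : U) : Prop :=
  ∃ P ∈ Ps, ∃ P' ∈ Ps, P ≠ P' ∧ DistinguishesWell inv Sv P P' s

def MaxElems (O : Set U) : Set U :=
  {x ∈ O | ∀ y ∈ O, x ≤ y → x = y}

/-- `σ` is a node of the nested set `N` (represented with all orientations of its elements) -/
def IsNode (inv : U → U) (N σ : Set U) : Prop :=
  IsStarIn inv N σ ∧ ∃ O, IsOrientation inv N O ∧ Consistent inv O ∧ σ = MaxElems O

def IsTrivialIn (inv : U → U) (Sv : Set U) (s : U) : Prop :=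
  ∃ r ∈ Sv, ({r, inv r} : Set U) ≠ {s, inv s} ∧ s < r ∧ s < inv r

def SmallSep (inv : U → U) (s : U) : Prop := s ≤ inv s

def StandardSet (inv : U → U) (Sv : Set U) (F : Set (Set U)) : Prop :=
  ∀ s ∈ Sv, IsTrivialIn inv Sv s → ({inv s} : Set U) ∈ F

def Emulates (inv : U → U) (Sv : Set U) (r s : U) : Prop :=
  r ≤ s ∧ ∀ x ∈ Sv, r ≤ x → x ≠ inv r → s ⊔ x ∈ Sv

open Classical in
/-- the shifting map `f↓` -/
noncomputable def shiftMap (inv : U → U) (r s x : U) : U :=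
  if r ≤ x then x ⊔ s else inv (inv x ⊔ s)

def ClosedUnderShifting (inv : U → U) (Sv : Set U) (F : Set (Set U)) : Prop :=
  ∀ r ∈ Sv, ∀ s ∈ Sv, inv r ≠ r → ¬ IsTrivialIn inv Sv r → Emulates inv Sv r s →
    ∀ σ ∈ F, (∀ x ∈ σ, x ∈ Sv ∧ (r ≤ x ∨ r ≤ inv x) ∧ x ≠ inv r) →
      (∃ t ∈ σ, r ≤ t) → shiftMap inv r s '' σ ∈ F

def Friendly (inv : U → U) (Sv : Set U) (F : Set (Set U)) : Prop :=
  (∀ σ ∈ F, IsStarIn inv Sv σ) ∧ StandardSet inv Sv F ∧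
    ClosedUnderShifting inv Sv F ∧
    (∀ s ∈ Sv, SmallSep inv s → ({inv s} : Set U) ∈ F) ∧
    ∀ O, IsFTangle inv Sv F O → IsProfile inv Sv O

def IsAut (inv : U → U) (Sv : Set U) (φ : U → U) : Prop :=
  Set.BijOn φ Sv Sv ∧ (∀ r ∈ Sv, ∀ s ∈ Sv, (r ≤ s ↔ φ r ≤ φ s)) ∧
    ∀ s ∈ Sv, φ (inv s) = inv (φ s)

/-- the separations of `Sv` that are nested with all separations in `M` -/
def SvM (inv : U → U) (Sv M : Set U) : Set U :=
  {s ∈ Sv | NestedWithAll inv M s}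

/-- the set `E_P` of `P`-exclusive separations in `P_M` distinguishing `P` well
from some other profile in `Ps` -/
def EP (inv : U → U) (Sv M : Set U) (Ps : Set (Set U)) (P : Set U) : Set U :=
  {s ∈ P ∩ SvM inv Sv M | (∀ P' ∈ Ps, s ∈ P' → P' = P) ∧
    ∃ P' ∈ Ps, P' ≠ P ∧ DistinguishesWell inv Sv P P' s}

/-- the set `M_{P,i}` from the construction of the canonical nested set:
separations nested with the previously chosen set `N` that are `P`-exclusive
for the remaining profiles `Q` and maximal in `P ∩ S⃗_i` -/
def MpOf (inv : U → U) (Sv N : Set U) (Q : Set (Set U)) (P : Set U) : Set U :=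
  {s ∈ SvM inv Sv N | s ∈ P ∧ (∀ P' ∈ Q, s ∈ P' → P' = P) ∧
    ∀ x ∈ P ∩ SvM inv Sv N, s ≤ x → s = x}

def QiOf (inv : U → U) (Sv N : Set U) (Q : Set (Set U)) : Set (Set U) :=
  {P ∈ Q | (MpOf inv Sv N Q P).Nonempty}

/-- step `i` of the construction: the pair `(N_i, Ps_{≥ i+1})` -/
def constrStep (inv : U → U) (Sv : Set U) (Ps : Set (Set U)) : ℕ → Set U × Set (Set U)
  | 0 => (∅, Ps)
  | (i+1) =>
      let p := constrStep inv Sv Ps i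
      (p.1 ∪ {x | ∃ P ∈ QiOf inv Sv p.1 p.2, ∃ y,
          IsGLB (MpOf inv Sv p.1 p.2 P) y ∧ (x = y ∨ x = inv y)},
        p.2 \ QiOf inv Sv p.1 p.2)

/-- the least `K` such that `Ps_{≥ K+1}` contains at most one profile -/
noncomputable def stopIndex (inv : U → U) (Sv : Set U) (Ps : Set (Set U)) : ℕ :=
  sInf {i | ((constrStep inv Sv Ps i).2).Subsingleton}

/-- the canonical nested set `N(S⃗, Ps)` -/
noncomputable def canonicalN (inv : U → U) (Sv : Set U) (Ps : Set (Set U)) : Set U :=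
  (constrStep inv Sv Ps (stopIndex inv Sv Ps)).1

end SepSys

open SepSys

namespace SepSys

variable {U : Type*} [Lattice U] {inv : U → U} {Sv P Q Q' M : Set U} {Ps : Set (Set U)}

lemma IsInvol.map_sup (hinv : IsInvol inv) (a b : U) : inv (a ⊔ b) = inv a ⊓ inv b := by
  refine le_antisymm (le_inf (hinv.2 _ _ le_sup_left) (hinv.2 _ _ le_sup_right)) ?_
  have ha := hinv.2 _ _ (inf_le_left : inv a ⊓ inv b ≤ inv a)
  have hb := hinv.2 _ _ (inf_le_right : inv a ⊓ inv b ≤ inv b)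
  rw [hinv.1] at ha hb
  simpa only [hinv.1] using hinv.2 _ _ (sup_le ha hb)

lemma IsInvol.map_inf (hinv : IsInvol inv) (a b : U) : inv (a ⊓ b) = inv a ⊔ inv b := by
  rw [← hinv.1 (inv a ⊔ inv b), hinv.map_sup, hinv.1, hinv.1]

lemma IsProfile.inv_notMem (hP : IsProfile inv Sv P) {a : U} (ha : a ∈ P) : inv a ∉ P := by
  simpa using hP.2.2 a ha a ha

lemma IsProfile.sup_mem (hP : IsProfile inv Sv P) {a b : U} (ha : a ∈ P) (hb : b ∈ P)
    (hab : a ⊔ b ∈ Sv) : a ⊔ b ∈ P :=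
  (hP.1.2.1 _ hab).resolve_right (hP.2.2 a ha b hb)

lemma IsProfile.eq_of_inv_le (hP : IsProfile inv Sv P) {a b : U}
    (ha : a ∈ P) (hb : b ∈ P) (hab : inv a ≤ b) : a = b := by
  by_contra hne
  rcases hab.lt_or_eq with hlt | heq
  · exact hP.2.1 a ha b hb hne hlt
  · exact hP.inv_notMem ha (heq ▸ hb)

/-- Profiles are closed downwards, up to the inverse of the larger separation. -/
lemma IsProfile.mem_or_eq_inv_of_le (hinv : IsInvol inv) (hP : IsProfile inv Sv P) {a b : U}
    (ha : a ∈ Sv) (hb : b ∈ P) (hab : a ≤ b) : a ∈ P ∨ a = inv b := by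
  refine (hP.1.2.1 a ha).imp_right fun h => ?_
  rw [← hP.eq_of_inv_le h hb ((hinv.1 a).symm ▸ hab), hinv.1]

lemma IsProfile.inv_mem_of_le (hinv : IsInvol inv) (hsys : IsSepSys inv Sv)
    (hP : IsProfile inv Sv P) (hQ : IsProfile inv Sv Q) {a b : U}
    (ha : a ∈ P) (hb : b ∈ P) (haQ : inv a ∈ Q) (hab : a ≤ b) : inv b ∈ Q := by
  refine (hQ.mem_or_eq_inv_of_le hinv (hsys _ (hP.1.1 hb)) haQ (hinv.2 _ _ hab)).resolve_right
    fun h => hP.inv_notMem hb ?_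
  rwa [h, hinv.1]

/-- A set on which all profiles agree contains no separation good for these profiles. -/
lemma GoodFor.not_agree (hPs : ∀ P ∈ Ps, IsProfile inv Sv P)
    (hagree : ∀ P ∈ Ps, ∀ P' ∈ Ps, P ∩ M = P' ∩ M) {m : U} (hm : m ∈ M) :
    ¬ GoodFor inv Sv Ps m := by
  rintro ⟨P, hP, P', hP', -, h | h⟩
  · have h1 : m ∈ P' ∩ M := hagree P hP P' hP' ▸ ⟨h.1.1, hm⟩
    exact (hPs P' hP').inv_notMem h1.1 h.2.1
  · have h1 : m ∈ P ∩ M := hagree P' hP' P hP ▸ ⟨h.1.1, hm⟩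
    exact (hPs P hP).inv_notMem h1.1 h.2.1

lemma CloselyRelated.inv_sup (hinv : IsInvol inv) (hsys : IsSepSys inv Sv)
    (hP : IsProfile inv Sv P) (hQ : IsProfile inv Sv Q) (hQ' : IsProfile inv Sv Q') {r s : U}
    (hr : r ∈ P) (hrs : r ⊔ s ∈ P) (hrQ' : inv r ∈ Q')
    (hcr : CloselyRelated inv Sv Q (inv r)) (hcs : CloselyRelated inv Sv Q' (inv s)) :
    CloselyRelated inv Sv Q (inv (r ⊔ s)) := by
  refine ⟨hP.inv_mem_of_le hinv hsys hQ hr hrs hcr.1 le_sup_left, fun q hq => ?_⟩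
  have hmem : inv r ⊓ q ∈ Q' := by
    refine (hQ'.mem_or_eq_inv_of_le hinv (hcr.2 q hq) hrQ' inf_le_left).resolve_right fun h => ?_
    have heq := hQ.eq_of_inv_le hcr.1 hq (h ▸ inf_le_right)
    rw [← heq, inf_idem] at h
    exact hQ'.inv_notMem hrQ' (h ▸ hrQ')
  rw [hinv.map_sup, inf_comm (inv r), inf_assoc]
  exact hcs.2 _ hmem

/-- If `u ∈ P` is not closely related to `P` but its inverse is closely related to `Q`, then some
larger element of `P` has an inverse closely related to `Q`. -/
lemma CloselyRelated.exists_lt (hinv : IsInvol inv) (hfin : Sv.Finite) (hsys : IsSepSys inv Sv)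
    (hsub : SubmodularSys Sv) (hP : IsProfile inv Sv P) (hQ : IsProfile inv Sv Q) {u : U}
    (hu : u ∈ P) (hcu : CloselyRelated inv Sv Q (inv u)) (hnu : ¬ CloselyRelated inv Sv P u) :
    ∃ v ∈ P, u < v ∧ CloselyRelated inv Sv Q (inv v) := by
  obtain ⟨p₀, hp₀, hup₀⟩ : ∃ p ∈ P, u ⊓ p ∉ Sv := by
    by_contra! h
    exact hnu ⟨hu, h⟩
  have huS := hP.1.1 hu
  obtain ⟨p, ⟨hpS, hupP, hup⟩, hmin⟩ :=
    (hfin.subset (Set.sep_subset Sv fun p => u ⊔ p ∈ P ∧ u ⊓ p ∉ Sv)).exists_minimal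
      ⟨p₀, hP.1.1 hp₀, hP.sup_mem hu hp₀
        ((hsub u huS p₀ (hP.1.1 hp₀)).resolve_right hup₀), hup₀⟩
  have hpu : ¬ p ≤ u := fun h => hup (by rwa [inf_eq_right.2 h])
  have hvQ := hP.inv_mem_of_le hinv hsys hQ hu hupP hcu.1 le_sup_left
  refine ⟨u ⊔ p, hupP, left_lt_sup.2 hpu, hvQ, fun q hq => ?_⟩
  -- `w` is the inverse of the corner `inv u ⊓ q`.
  obtain ⟨w, hw⟩ : ∃ w, w = u ⊔ inv q := ⟨_, rfl⟩
  have hwS : w ∈ Sv := by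
    have := hsys _ (hcu.2 q hq)
    rwa [hinv.map_inf, hinv.1, ← hw] at this
  have huw : u ≤ w := hw ▸ le_sup_left
  have heq : inv (u ⊔ p) ⊓ q = inv (p ⊔ w) := by
    rw [hw, hinv.map_sup, hinv.map_sup, hinv.map_sup, hinv.1, inf_comm (inv u), inf_assoc]
  rw [heq]
  apply hsys
  by_contra hpw
  have hpwS := (hsub p hpS w hwS).resolve_left hpw
  have hmeet : u ⊓ (p ⊓ w) = u ⊓ p := by
    rw [inf_comm p, ← inf_assoc, inf_eq_left.2 huw]
  have hnmeet : u ⊓ (p ⊓ w) ∉ Sv := hmeet ▸ hup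
  have hjS := (hsub u huS _ hpwS).resolve_right hnmeet
  have hjP : u ⊔ p ⊓ w ∈ P := by
    refine (hP.mem_or_eq_inv_of_le hinv hjS hupP
      (sup_le_sup_left inf_le_left u)).resolve_right fun h => hpu ?_
    have huv : u ≤ inv (u ⊔ p) := h ▸ le_sup_left
    rcases hQ.mem_or_eq_inv_of_le hinv huS hvQ huv with huQ | hEq
    · exact absurd hcu.1 (hQ.inv_notMem huQ)
    · rw [hinv.1] at hEq
      exact le_sup_right.trans hEq.ge
  have hle : p ≤ p ⊓ w := hmin ⟨hpwS, hjP, hnmeet⟩ inf_le_left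
  exact hpw (by rwa [sup_eq_right.2 (hle.trans inf_le_right)])

/-- An element of `P` whose inverse is closely related to `Q` lies below one which distinguishes
`P` and `Q` well. -/
lemma CloselyRelated.exists_distinguishesWell (hinv : IsInvol inv) (hfin : Sv.Finite)
    (hsys : IsSepSys inv Sv) (hsub : SubmodularSys Sv) (hP : IsProfile inv Sv P)
    (hQ : IsProfile inv Sv Q) {t : U} (ht : t ∈ P) (hct : CloselyRelated inv Sv Q (inv t)) :
    ∃ u ∈ P, t ≤ u ∧ DistinguishesWell inv Sv P Q u := by
  obtain ⟨u, ⟨hu, htu, hcu⟩, hmax⟩ :=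
    ((hfin.subset hP.1.1).subset
      (Set.sep_subset P fun u => t ≤ u ∧ CloselyRelated inv Sv Q (inv u))).exists_maximal
      ⟨t, ht, le_rfl, hct⟩
  refine ⟨u, hu, htu, Or.inl ⟨?_, hcu⟩⟩
  by_contra hnu
  obtain ⟨v, hv, huv, hcv⟩ := hcu.exists_lt hinv hfin hsys hsub hP hQ hu hnu
  exact huv.not_ge (hmax ⟨hv, htu.trans huv.le, hcv⟩ huv.le)

end SepSys

theorem good_separation_above_join {U : Type*} [Lattice U] (inv : U → U) (Sv : Set U)
    (hinv : IsInvol inv) (hfin : Sv.Finite) (hsys : IsSepSys inv Sv)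
    (hsub : SubmodularSys Sv)
    (Ps : Set (Set U)) (hPs : ∀ P ∈ Ps, IsProfile inv Sv P)
    (M : Set U) (hM : UnorientedIn inv Sv M) (hMnested : NestedSet inv M)
    (hMgood : ∀ m ∈ M, GoodFor inv Sv Ps m)
    (hMagree : ∀ P ∈ Ps, ∀ P' ∈ Ps, P ∩ M = P' ∩ M)
    (P Q Q' : Set U) (hPmem : P ∈ Ps) (hQmem : Q ∈ Ps) (hQ'mem : Q' ∈ Ps)
    (hPQ : P ≠ Q) (hPQ' : P ≠ Q') (hQQ' : Q ≠ Q')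
    (r s : U) (hr : r ∈ P ∩ SvM inv Sv M) (hs : s ∈ P ∩ SvM inv Sv M) (hrs : r ≠ s)
    (hrQ' : inv r ∈ Q') (hsQ' : inv s ∈ Q')
    (hcrQ : CloselyRelated inv Sv Q (inv r)) (hcsQ' : CloselyRelated inv Sv Q' (inv s)) :
    ∃ u ∈ P ∩ SvM inv Sv M, r ⊔ s ≤ u ∧ DistinguishesWell inv Sv P Q u := by
  have hP := hPs P hPmem
  have hQ := hPs Q hQmem
  have hjoinS : r ⊔ s ∈ Sv := by
    have := hsys _ (hcsQ'.2 _ hrQ')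
    rwa [hinv.map_inf, hinv.1, hinv.1, sup_comm] at this
  have hjoin := hP.sup_mem hr.1 hs.1 hjoinS
  have hc := hcrQ.inv_sup hinv hsys hP hQ (hPs Q' hQ'mem) hr.1 hjoin hrQ' hcsQ'
  obtain ⟨u, hu, hle, hdist⟩ :=
    hc.exists_distinguishesWell hinv hfin hsys hsub hP hQ hjoin
  exact ⟨u, ⟨hu, hP.1.1 hu, fun m hm =>
    absurd (hMgood m hm) (GoodFor.not_agree hPs hMagree hm)⟩, hle, hdist⟩
end

section
/- Let S⃗ be a finite submodular separation system inside a universe of separations, let 𝒫 be a set of profiles of S containing at least two profiles, suppose S is non-empty, and let M ⊆ S be a nested set of separations, each good for 𝒫, such that all profiles in 𝒫 contain exactly the same orientations of the elements of M. Then E_P is non-empty for some profile P ∈ 𝒫. -/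
open SepSys

namespace SepSys

variable {U : Type*} [Lattice U] {inv : U → U} {Sv P Q O : Set U} {r s t x : U}

theorem IsInvol.inv_le_comm (h : IsInvol inv) : inv r ≤ s ↔ inv s ≤ r :=
  ⟨fun hrs => h.1 r ▸ h.2 _ _ hrs, fun hsr => h.1 s ▸ h.2 _ _ hsr⟩

theorem IsInvol.le_inv_comm (h : IsInvol inv) : r ≤ inv s ↔ s ≤ inv r :=
  ⟨fun hrs => h.1 s ▸ h.2 _ _ hrs, fun hsr => h.1 r ▸ h.2 _ _ hsr⟩

theorem IsInvol.inv_sup (h : IsInvol inv) : inv (r ⊔ s) = inv r ⊓ inv s :=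
  le_antisymm (le_inf (h.2 _ _ le_sup_left) (h.2 _ _ le_sup_right))
    (h.le_inv_comm.1 (sup_le (h.le_inv_comm.1 inf_le_left) (h.le_inv_comm.1 inf_le_right)))

theorem IsInvol.inv_inf (h : IsInvol inv) : inv (r ⊓ s) = inv r ⊔ inv s := by
  rw [← h.1 (inv r ⊔ inv s), h.inv_sup, h.1, h.1]

namespace IsProfile

theorem mem_sys (hP : IsProfile inv Sv P) (hs : s ∈ P) : s ∈ Sv := hP.1.1 hs

theorem inv_notMem_s16 (hP : IsProfile inv Sv P) (hs : s ∈ P) : inv s ∉ P := fun hs' =>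
  hP.2.2 s hs s hs (by rwa [sup_idem])

theorem inv_mem (hP : IsProfile inv Sv P) (hs : s ∈ Sv) (hsP : s ∉ P) : inv s ∈ P :=
  (hP.1.2.1 s hs).resolve_left hsP

theorem sup_mem_s16 (hP : IsProfile inv Sv P) (hr : r ∈ P) (hs : s ∈ P) (h : r ⊔ s ∈ Sv) :
    r ⊔ s ∈ P :=
  (hP.1.2.1 _ h).resolve_right (hP.2.2 r hr s hs)

/-- Profiles are down-closed, except that an element may lie above its own inverse. -/
theorem mem_of_le (hinv : IsInvol inv) (hP : IsProfile inv Sv P) (ht : t ∈ P) (hs : s ∈ Sv)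
    (hst : s ≤ t) (hne : s ≠ inv t) : s ∈ P := by
  by_contra hsP
  have hlt : s < t := lt_of_le_of_ne hst fun h => hsP (h ▸ ht)
  refine hP.2.1 _ (hP.inv_mem hs hsP) t ht (fun h => hne ?_) ?_
  · rw [← h, hinv.1]
  · rwa [hinv.1]

theorem inf_ne_inv (hinv : IsInvol inv) (hsys : IsSepSys inv Sv) (hP : IsProfile inv Sv P)
    (hr : r ∈ P) (hs : s ∈ P) : r ⊓ s ≠ inv r := by
  intro h
  refine hP.inv_notMem_s16 hs (hP.mem_of_le hinv hr (hsys _ (hP.mem_sys hs)) ?_ ?_)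
  · exact hinv.inv_le_comm.1 (h ▸ inf_le_right)
  · intro h'
    have hsr : s = r := by rw [← hinv.1 s, h', hinv.1]
    rw [hsr, inf_idem] at h
    exact hP.inv_notMem_s16 hr (h ▸ hr)

theorem inf_mem (hinv : IsInvol inv) (hsys : IsSepSys inv Sv) (hP : IsProfile inv Sv P)
    (hr : r ∈ P) (hs : s ∈ P) (h : r ⊓ s ∈ Sv) : r ⊓ s ∈ P :=
  hP.mem_of_le hinv hr h inf_le_left (hP.inf_ne_inv hinv hsys hr hs)

theorem eq_of_inv_le_s16 (hinv : IsInvol inv) (hsys : IsSepSys inv Sv) (hP : IsProfile inv Sv P)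
    (ht : t ∈ P) (hs : s ∈ P) (h : inv t ≤ t) (hts : t ≤ s) : s = t := by
  by_contra hne
  refine hP.inv_notMem_s16 hs (hP.mem_of_le hinv ht (hsys _ (hP.mem_sys hs))
    ((hinv.2 _ _ hts).trans h) fun h' => hne ?_)
  rw [← hinv.1 s, h', hinv.1]

theorem exists_mem_inv_mem (hP : IsProfile inv Sv P) (hQ : IsProfile inv Sv Q) (hne : P ≠ Q) :
    ∃ s ∈ P, inv s ∈ Q := by
  by_contra! h
  have hPQ : P ⊆ Q := fun s hs => by
    by_contra hsQ
    exact h s hs (hQ.inv_mem (hP.mem_sys hs) hsQ)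
  refine hne (hPQ.antisymm fun s hs => ?_)
  by_contra hsP
  exact hQ.inv_notMem_s16 hs (hPQ (hP.inv_mem (hQ.mem_sys hs) hsP))

theorem closelyRelated_of_maximal (hsub : SubmodularSys Sv) (hP : IsProfile inv Sv P)
    (hs : Maximal (· ∈ P) s) : CloselyRelated inv Sv P s := by
  refine ⟨hs.1, fun u hu => ?_⟩
  rcases hsub s (hP.mem_sys hs.1) u (hP.mem_sys hu) with h | h
  · have hus : u ≤ s := le_sup_right.trans (hs.2 (hP.sup_mem_s16 hs.1 hu h) le_sup_left)
    rw [inf_eq_right.2 hus]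
    exact hP.mem_sys hu
  · exact h

/-- Shrinking a separation closely related to `Q` to make its inverse closely related to `P`. -/
theorem exists_le_closelyRelated (hinv : IsInvol inv) (hfin : Sv.Finite) (hsys : IsSepSys inv Sv)
    (hsub : SubmodularSys Sv) (hP : IsProfile inv Sv P) (hQ : IsProfile inv Sv Q)
    (hx : CloselyRelated inv Sv Q x) (hxP : inv x ∈ P) :
    ∃ y ≤ x, CloselyRelated inv Sv Q y ∧ CloselyRelated inv Sv P (inv y) := by
  obtain ⟨y, hyx, ⟨hyQ, hyP⟩, hymin⟩ := Set.Finite.exists_le_minimal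
    (s := {y | CloselyRelated inv Sv Q y ∧ inv y ∈ P})
    (hfin.subset fun y hy => hQ.mem_sys hy.1.1) ⟨hx, hxP⟩
  refine ⟨y, hyx, hyQ, hyP, ?_⟩
  by_contra! hbad
  obtain ⟨v₀, hv₀P, hv₀⟩ := hbad
  obtain ⟨v, -, ⟨hvP, hv⟩, hvmin⟩ := Set.Finite.exists_le_minimal
    (s := {v | v ∈ P ∧ inv y ⊓ v ∉ Sv}) (hfin.subset fun v hv => hP.mem_sys hv.1) ⟨hv₀P, hv₀⟩
  have hvS := hP.mem_sys hvP
  have hjoin : inv y ⊔ v ∈ Sv := (hsub _ (hP.mem_sys hyP) v hvS).resolve_right hv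
  have hjoinP : inv y ⊔ v ∈ P := hP.sup_mem_s16 hyP hvP hjoin
  have hw : inv (y ⊓ inv v) = inv y ⊔ v := by rw [hinv.inv_inf, hinv.1]
  have hwS : y ⊓ inv v ∈ Sv := by
    rw [← hinv.1 (y ⊓ inv v), hw]
    exact hsys _ hjoin
  have hwQ : y ⊓ inv v ∈ Q := by
    refine hQ.mem_of_le hinv hyQ.1 hwS inf_le_left fun h => ?_
    rw [h, hinv.1] at hw
    exact hP.inv_notMem_s16 (hw ▸ hjoinP) hyP
  have hwc : CloselyRelated inv Sv Q (y ⊓ inv v) := by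
    refine ⟨hwQ, fun u hu => ?_⟩
    have huS := hyQ.2 u hu
    rw [inf_right_comm]
    rcases hsub _ huS _ (hsys v hvS) with hj | hm
    swap
    · exact hm
    have hz : inv (y ⊓ u) ⊓ v ∈ Sv := by
      have := hsys _ hj
      rwa [hinv.inv_sup, hinv.1] at this
    have hyz : inv y ⊓ (inv (y ⊓ u) ⊓ v) = inv y ⊓ v := by
      rw [← inf_assoc, inf_eq_left.2 (hinv.2 _ _ inf_le_left)]
    have hzP : inv (y ⊓ u) ⊓ v ∈ P := by
      refine hP.mem_of_le hinv hvP hz inf_le_right fun h => hv ?_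
      have hvv : inv v ≤ v := h ▸ inf_le_right
      have := hP.eq_of_inv_le_s16 hinv hsys hvP hjoinP hvv le_sup_right
      rw [inf_eq_left.2 (sup_eq_right.1 this)]
      exact hP.mem_sys hyP
    have hvz : v ≤ inv (y ⊓ u) := (hvmin ⟨hzP, hyz ▸ hv⟩ inf_le_right).trans inf_le_left
    rw [inf_eq_left.2 (hinv.le_inv_comm.1 hvz)]
    exact huS
  have hyv : y ≤ inv v := (hymin ⟨hwc, hw ▸ hjoinP⟩ inf_le_left).trans inf_le_right
  exact hv (by rw [inf_eq_right.2 (hinv.le_inv_comm.1 hyv)]; exact hvS)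

theorem exists_distinguishesWell (hinv : IsInvol inv) (hfin : Sv.Finite) (hsys : IsSepSys inv Sv)
    (hsub : SubmodularSys Sv) (hP : IsProfile inv Sv P) (hQ : IsProfile inv Sv Q) (hne : P ≠ Q) :
    ∃ s, CloselyRelated inv Sv P s ∧ CloselyRelated inv Sv Q (inv s) := by
  obtain ⟨s, hsP, hsQ⟩ := hP.exists_mem_inv_mem hQ hne
  obtain ⟨m, hsm, hm⟩ := (hfin.subset hP.1.1).exists_le_maximal hsP
  have hmQ : inv m ∈ Q := by
    refine hQ.mem_of_le hinv hsQ (hsys m (hP.mem_sys hm.1)) (hinv.2 _ _ hsm) fun h => ?_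
    rw [hinv.1] at h
    exact hP.inv_notMem_s16 hm.1 (h ▸ hsP)
  obtain ⟨y, -, hyP, hyQ⟩ := hQ.exists_le_closelyRelated hinv hfin hsys hsub hP
    (hP.closelyRelated_of_maximal hsub hm) hmQ
  exact ⟨y, hyP, hyQ⟩

theorem inf_closelyRelated (hinv : IsInvol inv) (hsys : IsSepSys inv Sv)
    (hP : IsProfile inv Sv P) (hQ : IsProfile inv Sv Q) (hO : IsProfile inv Sv O)
    (hx : CloselyRelated inv Sv Q x) (hr : CloselyRelated inv Sv P r) (hrQ : r ∈ Q)
    (hxO : inv x ∈ O) (hrO : inv r ∈ O) :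
    CloselyRelated inv Sv P (x ⊓ r) ∧ inv (x ⊓ r) ∈ O := by
  have hS : x ⊓ r ∈ Sv := hx.2 r hrQ
  have hmem : inv (x ⊓ r) ∈ O := by
    have := hsys _ hS
    rw [hinv.inv_inf] at this ⊢
    exact hO.sup_mem_s16 hxO hrO this
  refine ⟨⟨hP.mem_of_le hinv hr.1 hS inf_le_right fun h => ?_, fun p hp => ?_⟩, hmem⟩
  · rw [h] at hmem
    exact hO.inv_notMem_s16 hrO hmem
  · rw [inf_assoc]
    exact hx.2 _ (hQ.mem_of_le hinv hrQ (hr.2 p hp) inf_le_left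
      (hP.inf_ne_inv hinv hsys hr.1 hp))

/-- Profiles containing `inv y` contain `inv x` if `y ≤ x`, provided some profile `O` contains
both. -/
theorem inv_mem_of_le_s16 (hinv : IsInvol inv) (hP : IsProfile inv Sv P)
    (hO : IsProfile inv Sv O) {y : U} (hyx : y ≤ x) (hxO : inv x ∈ O) (hyO : inv y ∈ O)
    (hyP : inv y ∈ P) : inv x ∈ P := by
  refine hP.mem_of_le hinv hyP (hO.mem_sys hxO) (hinv.2 _ _ hyx) fun h => ?_
  exact hO.inv_notMem_s16 hyO (h ▸ hxO)

end IsProfile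

/-- Some profile `P` has an exclusive separation that distinguishes it well from another one. -/
theorem exists_exclusive_closelyRelated (hinv : IsInvol inv) (hfin : Sv.Finite)
    (hsys : IsSepSys inv Sv) (hsub : SubmodularSys Sv) {Ps : Set (Set U)}
    (hPs : ∀ P ∈ Ps, IsProfile inv Sv P) (hPs2 : ∃ P ∈ Ps, ∃ P' ∈ Ps, P ≠ P') :
    ∃ P ∈ Ps, ∃ Q ∈ Ps, ∃ s, CloselyRelated inv Sv P s ∧ CloselyRelated inv Sv Q (inv s) ∧
      ∀ P' ∈ Ps, s ∈ P' → P' = P := by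
  have hPsfin : Ps.Finite := hfin.finite_subsets.subset fun P hP => (hPs P hP).1.1
  obtain ⟨Q₀, hQ₀, P₀, hP₀, hne₀⟩ := hPs2
  obtain ⟨x₀, hx₀, hx₀'⟩ :=
    (hPs Q₀ hQ₀).exists_distinguishesWell hinv hfin hsys hsub (hPs P₀ hP₀) hne₀
  obtain ⟨D, -, ⟨x, Q, hQ, hx, hDne, rfl⟩, hDmin⟩ := Set.Finite.exists_le_minimal
    (s := {D | ∃ x, ∃ Q ∈ Ps, CloselyRelated inv Sv Q x ∧ D.Nonempty ∧
      D = {P ∈ Ps | inv x ∈ P}})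
    (hPsfin.finite_subsets.subset (by rintro _ ⟨x, Q, -, -, -, rfl⟩; exact Set.sep_subset _ _))
    ⟨x₀, Q₀, hQ₀, hx₀, ⟨P₀, hP₀, hx₀'.1⟩, rfl⟩
  have key : ∀ a ∈ Ps, ∀ b ∈ Ps, inv x ∈ a → inv x ∈ b → ∀ r, CloselyRelated inv Sv a r →
      inv r ∈ b → r ∉ Q := by
    intro a ha b hb hxa hxb r hra hrb hrQ
    obtain ⟨hc, hcb⟩ := (hPs a ha).inf_closelyRelated hinv hsys (hPs Q hQ) (hPs b hb)
      hx hra hrQ hxb hrb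
    have hle : {P ∈ Ps | inv x ∈ P} ⊆ {P ∈ Ps | inv (x ⊓ r) ∈ P} :=
      hDmin ⟨x ⊓ r, a, ha, hc, ⟨b, hb, hcb⟩, rfl⟩ fun P hP => ⟨hP.1, (hPs P hP.1).inv_mem_of_le_s16 hinv
        (hPs b hb) inf_le_left hxb hcb hP.2⟩
    exact (hPs a ha).inv_notMem_s16 hc.1 (@hle a ⟨ha, hxa⟩).2
  obtain ⟨P, hP, hxP⟩ := hDne
  have huniq : ∀ P' ∈ Ps, inv x ∈ P' → P' = P := by
    intro P' hP' hxP'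
    by_contra hne
    obtain ⟨r, hr, hr'⟩ :=
      (hPs P' hP').exists_distinguishesWell hinv hfin hsys hsub (hPs P hP) hne
    refine key P hP P' hP' hxP hxP' (inv r) hr' ((hinv.1 r).symm ▸ hr.1) ?_
    exact (hPs Q hQ).inv_mem ((hPs P' hP').mem_sys hr.1)
      (key P' hP' P hP hxP' hxP r hr hr'.1)
  obtain ⟨y, hyx, hyQ, hyP⟩ := (hPs P hP).exists_le_closelyRelated hinv hfin hsys hsub
    (hPs Q hQ) hx hxP
  exact ⟨P, hP, Q, hQ, inv y, hyP, (hinv.1 y).symm ▸ hyQ, fun P' hP' hy => huniq P' hP'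
    ((hPs P' hP').inv_mem_of_le_s16 hinv (hPs P hP) hyx hxP hyP.1 hy)⟩

end SepSys

theorem some_EP_nonempty {U : Type*} [Lattice U] (inv : U → U) (Sv : Set U)
    (hinv : IsInvol inv) (hfin : Sv.Finite) (hsys : IsSepSys inv Sv)
    (hsub : SubmodularSys Sv)
    (Ps : Set (Set U)) (hPs : ∀ P ∈ Ps, IsProfile inv Sv P)
    (M : Set U) (hM : UnorientedIn inv Sv M) (hMnested : NestedSet inv M)
    (hMgood : ∀ m ∈ M, GoodFor inv Sv Ps m)
    (hMagree : ∀ P ∈ Ps, ∀ P' ∈ Ps, P ∩ M = P' ∩ M)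
    (hPs2 : ∃ P ∈ Ps, ∃ P' ∈ Ps, P ≠ P') (hSne : Sv.Nonempty) :
    ∃ P ∈ Ps, (EP inv Sv M Ps P).Nonempty := by
  -- profiles contain no degenerate separations, so good separations on which they agree are absent
  have hMempty : ∀ m, m ∉ M := by
    intro m hm
    obtain ⟨P, hP, P', hP', -, h | h⟩ := hMgood m hm
    · exact (hPs P' hP').inv_notMem_s16 ((hMagree P hP P' hP').subset ⟨h.1.1, hm⟩).1 h.2.1
    · exact (hPs P hP).inv_notMem_s16 ((hMagree P' hP' P hP).subset ⟨h.1.1, hm⟩).1 h.2.1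
  obtain ⟨P, hP, Q, hQ, s, hsP, hsQ, hs⟩ :=
    exists_exclusive_closelyRelated hinv hfin hsys hsub hPs hPs2
  refine ⟨P, hP, s, ⟨hsP.1, (hPs P hP).mem_sys hsP.1, fun m hm => absurd hm (hMempty m)⟩, hs,
    Q, hQ, fun h => ?_, Or.inl ⟨hsP, hsQ⟩⟩
  exact (hPs P hP).inv_notMem_s16 hsP.1 (h ▸ hsQ.1)
end

section
/- Let S⃗ be a finite submodular separation system inside a universe of separations, let 𝒫 be a set of profiles of S, and let M ⊆ S be a nested set of separations, each good for 𝒫, such that all profiles in 𝒫 contain exactly the same orientations of the elements of M. Then for every profile P ∈ 𝒫, if E_P is non-empty then E_P contains a unique maximal element. -/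
open SepSys

namespace SepSys

variable {U : Type*} [Lattice U] {inv : U → U} {Sv P Q Q' : Set U} {r s t : U}

lemma IsInvol.inv_sup_s17 (h : IsInvol inv) (a b : U) : inv (a ⊔ b) = inv a ⊓ inv b := by
  apply le_antisymm
  · exact le_inf (h.2 _ _ le_sup_left) (h.2 _ _ le_sup_right)
  · have h1 := h.2 _ _ (inf_le_left : inv a ⊓ inv b ≤ inv a)
    have h2 := h.2 _ _ (inf_le_right : inv a ⊓ inv b ≤ inv b)
    rw [h.1] at h1 h2
    simpa only [h.1] using h.2 _ _ (sup_le h1 h2)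

lemma IsInvol.inv_inf_s17 (h : IsInvol inv) (a b : U) : inv (a ⊓ b) = inv a ⊔ inv b := by
  rw [← h.1 (inv a ⊔ inv b), h.inv_sup_s17, h.1, h.1]

lemma IsProfile.inv_mem_of_notMem (hP : IsProfile inv Sv P) (hr : r ∈ Sv) (h : r ∉ P) :
    inv r ∈ P :=
  (hP.1.2.1 r hr).resolve_left h

/-- Profiles are down-closed, except that a profile may contain `inv r` for small `r`. -/
lemma IsProfile.mem_of_le_s17 (hinv : IsInvol inv) (hP : IsProfile inv Sv P) (hs : s ∈ P)
    (hr : r ∈ Sv) (hrs : r ≤ s) (hne : inv r ≠ s) : r ∈ P := by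
  by_contra h
  refine hP.2.1 _ (hP.inv_mem_of_notMem hr h) s hs hne ?_
  rw [hinv.1]
  exact lt_of_le_of_ne hrs fun e => h (e ▸ hs)

/-- Exclusivity with respect to `Q` passes to larger elements of `P`. -/
lemma IsProfile.notMem_of_le (hinv : IsInvol inv) (hP : IsProfile inv Sv P)
    (hQ : IsProfile inv Sv Q) (hr : r ∈ P) (ht : t ∈ P) (hrt : r ≤ t) (hrQ : r ∉ Q) :
    t ∉ Q := by
  intro htQ
  refine hrQ (hQ.mem_of_le_s17 hinv htQ (hP.1.1 hr) hrt fun e => hrQ ?_)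
  rwa [← hP.1.2.2 r hr (e ▸ ht), e]

/-- If `inv r` is closely related to `Q` and `inv s` to `Q'`, where neither profile contains
`r` or `s`, then meeting with `inv (r ⊔ s)` maps `Q` into `Sv`. -/
lemma inv_sup_inf_mem (hinv : IsInvol inv) (hQ : IsProfile inv Sv Q)
    (hQ' : IsProfile inv Sv Q') (hrQ : r ∉ Q) (hrQ' : inv r ∈ Q')
    (hr : CloselyRelated inv Sv Q (inv r)) (hs : CloselyRelated inv Sv Q' (inv s))
    {y : U} (hy : y ∈ Q) : inv (r ⊔ s) ⊓ y ∈ Sv := by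
  have key : inv r ⊓ y ∈ Q' := by
    refine hQ'.mem_of_le_s17 hinv hrQ' (hr.2 y hy) inf_le_left fun e => ?_
    have e' : inv r ⊓ y = r := by rw [← hinv.1 (inv r ⊓ y), e, hinv.1]
    have hry : r ≤ y := e' ▸ inf_le_right
    by_cases hne : inv r = y
    · rw [← hne, inf_idem] at e'
      exact hrQ (e' ▸ hr.1)
    · refine hQ.2.1 _ hr.1 y hy hne ?_
      rw [hinv.1]
      exact lt_of_le_of_ne hry fun e => hrQ (e ▸ hy)
  have h := hs.2 _ key
  rwa [← inf_assoc, inf_comm (inv s), ← hinv.inv_sup_s17] at h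

/-- A maximal element of a profile is closely related to it. -/
lemma closelyRelated_of_maximal (hsub : SubmodularSys Sv) (hP : IsProfile inv Sv P)
    (ht : Maximal (· ∈ P) t) : CloselyRelated inv Sv P t := by
  refine ⟨ht.1, fun x hx => ?_⟩
  rcases hsub t (hP.1.1 ht.1) x (hP.1.1 hx) with h | h
  · have hmem : t ⊔ x ∈ P := (hP.1.2.1 _ h).resolve_right (hP.2.2 t ht.1 x hx)
    have hxt : x ≤ t := le_sup_right.trans (ht.2 hmem le_sup_left)
    rw [inf_eq_right.2 hxt]
    exact hP.1.1 hx
  · exact h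

/-- Every element of a profile `P` lies below an element `u` closely related to `P` whose join
with every separation above the given element is again a separation. -/
lemma exists_closelyRelated_ge (hinv : IsInvol inv) (hfin : Sv.Finite) (hsys : IsSepSys inv Sv)
    (hsub : SubmodularSys Sv) (hP : IsProfile inv Sv P) (ht : t ∈ P) :
    ∃ u, t ≤ u ∧ CloselyRelated inv Sv P u ∧ ∀ z ∈ Sv, t ≤ z → u ⊔ z ∈ Sv := by
  obtain ⟨v, htv, hv⟩ := (hfin.subset hP.1.1).exists_le_maximal ht
  have hCfin : {u | t ≤ u ∧ CloselyRelated inv Sv P u}.Finite :=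
    hfin.subset fun u hu => hP.1.1 hu.2.1
  obtain ⟨u, hu⟩ := hCfin.exists_minimal ⟨v, htv, closelyRelated_of_maximal hsub hP hv⟩
  have huP : u ∈ P := hu.1.2.1
  have huS : u ∈ Sv := hP.1.1 huP
  refine ⟨u, hu.1.1, hu.1.2, ?_⟩
  by_contra! hbad
  obtain ⟨z₀, hz₀, htz₀, hz₀u⟩ := hbad
  have hBfin : {z | z ∈ Sv ∧ t ≤ z ∧ u ⊔ z ∉ Sv}.Finite := hfin.subset fun z hz => hz.1
  obtain ⟨z, hz⟩ := hBfin.exists_maximal ⟨z₀, hz₀, htz₀, hz₀u⟩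
  obtain ⟨hzS, htz, hzu⟩ := hz.1
  have huz : u ⊓ z ∈ Sv := (hsub u huS z hzS).resolve_left hzu
  have hne : u ≠ z := by
    rintro rfl
    exact hzu (by rwa [sup_idem])
  have hclose : ∀ x ∈ P, u ⊓ z ⊓ x ∈ Sv := by
    intro x hx
    rw [inf_right_comm]
    rcases hsub (u ⊓ x) (hu.1.2.2 x hx) z hzS with h | h
    · have hB : u ⊔ ((u ⊓ x) ⊔ z) ∉ Sv := by rwa [← sup_assoc, sup_inf_self]
      have hxz : u ⊓ x ≤ z :=
        le_sup_left.trans (hz.2 ⟨h, htz.trans le_sup_right, hB⟩ le_sup_right)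
      rw [inf_eq_left.2 hxz]
      exact hu.1.2.2 x hx
    · exact h
  have hmem : u ⊓ z ∈ P := by
    refine hP.mem_of_le_s17 hinv huP huz inf_le_left fun e => ?_
    have e' : u ⊓ z = inv u := by rw [← hinv.1 (u ⊓ z), e]
    have hle : inv u ≤ z := e' ▸ inf_le_right
    rcases hP.1.2.1 z hzS with hzP | hzP
    · rcases hle.eq_or_lt with h | h
      · exact hne ((hP.1.2.2 u huP (h ▸ hzP)).symm.trans h)
      · exact hP.2.1 u huP z hzP hne h
    · have h := hsys _ (hclose _ hzP)
      rw [e', ← hinv.inv_sup_s17, hinv.1] at h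
      exact hzu h
  have huz' : u ≤ z := (hu.2 ⟨le_inf hu.1.1 htz, hmem, hclose⟩ inf_le_left).trans inf_le_right
  exact hzu (by rwa [sup_eq_right.2 huz'])

/-- All profiles contain the same separations nested with a given degenerate separation. -/
lemma mem_of_nested_degenerate (hinv : IsInvol inv) {P' : Set U} (hP : IsProfile inv Sv P)
    (hP' : IsProfile inv Sv P') {m : U} (hm : m ∈ Sv) (hmm : inv m = m) (hs : s ∈ P)
    (hnest : Nested inv s m) : s ∈ P' := by
  have hmP : m ∈ P := by simpa only [hmm, or_self] using hP.1.2.1 m hm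
  have hmP' : m ∈ P' := by simpa only [hmm, or_self] using hP'.1.2.1 m hm
  have hsS : s ∈ Sv := hP.1.1 hs
  have down : s ≤ m → s ∈ P' := fun h => by
    by_cases hsm : s = m
    · rwa [hsm]
    · refine hP'.mem_of_le_s17 hinv hmP' hsS h fun e => hsm ?_
      rw [← hinv.1 s, e, hmm]
  have up : inv s ≤ m → s ∈ P' := fun h => by
    have hms : m ≤ s := by simpa only [hmm, hinv.1] using hinv.2 _ _ h
    rcases hms.eq_or_lt with e | h
    · rwa [← e]
    · exact absurd (by rwa [hmm]) (hP.2.1 m hmP s hs h.ne)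
  rw [Nested, hmm] at hnest
  rcases hnest with h | h | h | h
  exacts [down h, down h, up h, up h]

lemma EP.closelyRelated {M : Set U} {Ps : Set (Set U)} (h : s ∈ EP inv Sv M Ps P) :
    ∃ Q ∈ Ps, Q ≠ P ∧ CloselyRelated inv Sv P s ∧ CloselyRelated inv Sv Q (inv s) := by
  obtain ⟨-, hex, Q, hQ, hne, h | h⟩ := h
  · exact ⟨Q, hQ, hne, h⟩
  · exact absurd (hex Q hQ h.1.1) hne

/-- If `M` consists of degenerate separations, then `EP` is directed. -/
lemma EP.exists_ge (hinv : IsInvol inv) (hfin : Sv.Finite) (hsys : IsSepSys inv Sv)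
    (hsub : SubmodularSys Sv) {Ps : Set (Set U)} (hPs : ∀ P ∈ Ps, IsProfile inv Sv P)
    {M : Set U} (hMS : M ⊆ Sv) (hM : ∀ m ∈ M, inv m = m) (hPP : P ∈ Ps)
    (hr : r ∈ EP inv Sv M Ps P) (hs : s ∈ EP inv Sv M Ps P) :
    ∃ u ∈ EP inv Sv M Ps P, r ≤ u ∧ s ≤ u := by
  have hP := hPs P hPP
  obtain ⟨Q, hQQ, hQne, -, hrQ⟩ := EP.closelyRelated hr
  obtain ⟨Q', hQQ', hQne', -, hsQ'⟩ := EP.closelyRelated hs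
  have hQ := hPs Q hQQ
  have hQ' := hPs Q' hQQ'
  have hrP : r ∈ P := hr.1.1
  have hsP : s ∈ P := hs.1.1
  have hrnQ : r ∉ Q := fun h => hQne (hr.2.1 Q hQQ h)
  have hsnQ : s ∉ Q := fun h => hQne (hs.2.1 Q hQQ h)
  have hrnQ' : r ∉ Q' := fun h => hQne' (hr.2.1 Q' hQQ' h)
  have hM0 : ∀ m, m ∉ M := fun m hm =>
    hrnQ (mem_of_nested_degenerate hinv hP hQ (hMS hm) (hM m hm) hrP (hr.1.2.2 m hm))
  have hmeet : ∀ y ∈ Q, inv (r ⊔ s) ⊓ y ∈ Sv := fun y hy =>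
    inv_sup_inf_mem hinv hQ hQ' hrnQ (hQ'.inv_mem_of_notMem (hP.1.1 hrP) hrnQ') hrQ hsQ' hy
  have hjoin : ∀ y ∈ Q, (r ⊔ s) ⊔ inv y ∈ Sv := fun y hy => by
    simpa only [hinv.inv_inf_s17, hinv.1] using hsys _ (hmeet y hy)
  have htS : r ⊔ s ∈ Sv := by
    simpa only [hinv.1, sup_assoc, sup_idem] using
      hjoin _ (hQ.inv_mem_of_notMem (hP.1.1 hsP) hsnQ)
  have htP : r ⊔ s ∈ P := (hP.1.2.1 _ htS).resolve_right (hP.2.2 r hrP s hsP)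
  obtain ⟨u, htu, hu, hzu⟩ := exists_closelyRelated_ge hinv hfin hsys hsub hP htP
  have hru : r ≤ u := le_sup_left.trans htu
  have huS : u ∈ Sv := hP.1.1 hu.1
  have hunot : ∀ R ∈ Ps, R ≠ P → u ∉ R := fun R hR hne =>
    hP.notMem_of_le hinv (hPs R hR) hrP hu.1 hru fun h => hne (hr.2.1 R hR h)
  refine ⟨u, ⟨⟨hu.1, huS, fun m hm => absurd hm (hM0 m)⟩,
    fun R hR huR => by_contra fun hne => hunot R hR hne huR, Q, hQQ, hQne,
    Or.inl ⟨hu, hQ.inv_mem_of_notMem huS (hunot Q hQQ hQne), fun y hy => ?_⟩⟩,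
    hru, le_sup_right.trans htu⟩
  have h := hsys _ (hzu _ (hjoin y hy) le_sup_left)
  rwa [← sup_assoc, sup_eq_left.2 htu, hinv.inv_sup_s17, hinv.1] at h

/-- If all profiles in `Ps` orient `M` alike, then an element of `M` that is good for `Ps` is
degenerate. -/
lemma GoodFor.inv_eq {Ps : Set (Set U)} {M : Set U} {m : U}
    (hPs : ∀ P ∈ Ps, IsProfile inv Sv P) (hM : ∀ s ∈ M, inv s ∈ M)
    (hagree : ∀ P ∈ Ps, ∀ P' ∈ Ps, P ∩ M = P' ∩ M) (hm : m ∈ M)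
    (h : GoodFor inv Sv Ps m) : inv m = m := by
  obtain ⟨P, hP, P', hP', -, h | h⟩ := h
  · have h' : inv m ∈ P ∩ M := hagree P' hP' P hP ▸ ⟨h.2.1, hM m hm⟩
    exact (hPs P hP).1.2.2 m h.1.1 h'.1
  · have h' : inv m ∈ P' ∩ M := hagree P hP P' hP' ▸ ⟨h.2.1, hM m hm⟩
    exact (hPs P' hP').1.2.2 m h.1.1 h'.1

end SepSys

theorem EP_unique_maximal_element {U : Type*} [Lattice U] (inv : U → U) (Sv : Set U)
    (hinv : IsInvol inv) (hfin : Sv.Finite) (hsys : IsSepSys inv Sv)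
    (hsub : SubmodularSys Sv)
    (Ps : Set (Set U)) (hPs : ∀ P ∈ Ps, IsProfile inv Sv P)
    (M : Set U) (hM : UnorientedIn inv Sv M) (hMnested : NestedSet inv M)
    (hMgood : ∀ m ∈ M, GoodFor inv Sv Ps m)
    (hMagree : ∀ P ∈ Ps, ∀ P' ∈ Ps, P ∩ M = P' ∩ M) :
    ∀ P ∈ Ps, (EP inv Sv M Ps P).Nonempty →
      ∃! m : U, Maximal (· ∈ EP inv Sv M Ps P) m := by
  intro P hP hne
  have hMdeg : ∀ m ∈ M, inv m = m := fun m hm =>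
    (hMgood m hm).inv_eq hPs hM.2 hMagree hm
  have hEfin : (EP inv Sv M Ps P).Finite := hfin.subset fun s hs => hs.1.2.1
  obtain ⟨m, hm⟩ := hEfin.exists_maximal hne
  refine ⟨m, hm, fun n hn => ?_⟩
  obtain ⟨u, hu, hmu, hnu⟩ := EP.exists_ge hinv hfin hsys hsub hPs hM.1 hMdeg hP hm.1 hn.1
  rw [hm.eq_of_le hu hmu, hn.eq_of_le hu hnu]
end
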